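/- Let n ≥ 4 and N(c-k)+k ≠ 0 with c, k, N positive integers and ℓ = gcd(N,k). Suppose χ_m = (-1)^{n+1} · ((N-ℓ)χ_H + ℓχ_M) / (2|N(c-k)+k|) must equal (-1)^{n+1} · k(χ_M - χ_H)/2 (the subcritical value), for the fixed N and for all positive multiples Nm of N replacing N (with ℓ replaced by gcd(Nm,k)). Then one of the following holds: (i) c ≥ k, k ∤ N, and χ_H = χ_M = 0; (ii) c = k, k | N, and χ_H = 0; (iii) c > k, k | N, and (k(c-k)+1)χ_H = k(c-k)χ_M. -/

import Mathlib

/-- Arithmetic core of distinguishing powers of fibered Dehn twists. -/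
theorem stmt6 (n c k N : ℕ) (hn : 4 ≤ n) (hk : 0 < k) (hN : 0 < N) (hc : k ≤ c)
    (χH χM : ℤ)
    (heq : ∀ m : ℕ, 0 < m →
      (((k : ℤ) * ((c : ℤ) - (k : ℤ)) + 1) * N * m + (k : ℤ) ^ 2
          - (Nat.gcd (N * m) k : ℤ) ^ 2) * χH =
      ((k : ℤ) * ((c : ℤ) - (k : ℤ)) * N * m + (k : ℤ) ^ 2
          - (Nat.gcd (N * m) k : ℤ) ^ 2) * χM) :
    (k ≤ c ∧ ¬ k ∣ N ∧ χH = 0 ∧ χM = 0) ∨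
    (c = k ∧ k ∣ N ∧ χH = 0) ∨
    (k < c ∧ k ∣ N ∧
      ((k : ℤ) * ((c : ℤ) - (k : ℤ)) + 1) * χH = (k : ℤ) * ((c : ℤ) - (k : ℤ)) * χM) := by
  have hmul : ((k : ℤ) * ((c : ℤ) - (k : ℤ)) + 1) * χH =
      (k : ℤ) * ((c : ℤ) - (k : ℤ)) * χM := by
    have h := heq k hk
    rw [Nat.gcd_mul_left_left] at h
    have hNk : (N : ℤ) * k ≠ 0 := by positivity
    apply mul_left_cancel₀ hNk
    linear_combination h
  by_cases hdvd : k ∣ N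
  · rcases hc.eq_or_lt with rfl | hlt
    · exact Or.inr (Or.inl ⟨rfl, hdvd, by simpa using hmul⟩)
    · exact Or.inr (Or.inr ⟨hlt, hdvd, hmul⟩)
  · have h := heq 1 one_pos
    rw [mul_one] at h
    have hgcd : N.gcd k < k :=
      lt_of_le_of_ne (Nat.gcd_le_right N hk) fun e => hdvd (Nat.gcd_eq_right_iff_dvd.mp e)
    have hpos : (0 : ℤ) < (k : ℤ) ^ 2 - (N.gcd k : ℤ) ^ 2 :=
      sub_pos.mpr (by exact_mod_cast Nat.pow_lt_pow_left hgcd two_ne_zero)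
    have hχ : χH = χM := by
      apply mul_left_cancel₀ hpos.ne'
      push_cast at h
      linear_combination h - (N : ℤ) * hmul
    subst hχ
    have hzero : χH = 0 := by linear_combination hmul
    exact Or.inl ⟨hc, hdvd, hzero, hzero⟩
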